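/- Let p > 3 be a prime, let q_1, …, q_r be distinct primes different from p (one of which may equal 2) with N = q_1⋯q_r squarefree, and let k be an integer with 0 ≤ k < r. Then the set of negative fundamental discriminants D with gcd(D, pN) = 1 such that p splits in ℚ(√D) and the set I = {i ∈ {1, …, r} : q_i is inert in ℚ(√D)} satisfies I ⊆ {k+1, …, r} and #I is odd, has density pN/(2^{k+2}·(p+1)·∏_{i=1}^{r}(q_i+1)) among all negative fundamental discriminants. -/

import Mathlib

open Filter Finset

/-- `D` is the discriminant of an imaginary quadratic field. -/
def IsNegFundDisc (D : ℤ) : Prop :=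
  D < 0 ∧ ((D % 4 = 1 ∧ Squarefree D) ∨
    ∃ d : ℤ, D = 4 * d ∧ Squarefree d ∧ (d % 4 = 2 ∨ d % 4 = 3))

/-- A prime `l` not dividing the negative fundamental discriminant `D` splits in `ℚ(√D)`:
for odd `l` this means the Legendre (= Jacobi) symbol `(D|l) = 1`; `2` splits iff
`D ≡ 1 (mod 8)`. -/
def SplitsIn (l : ℕ) (D : ℤ) : Prop :=
  if l = 2 then D % 8 = 1 else jacobiSym D l = 1

/-- A prime `l` not dividing the negative fundamental discriminant `D` is inert in `ℚ(√D)`: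
for odd `l` this means the Legendre (= Jacobi) symbol `(D|l) = -1`; `2` is inert iff
`D ≡ 5 (mod 8)`. -/
def InertIn (l : ℕ) (D : ℤ) : Prop :=
  if l = 2 then D % 8 = 5 else jacobiSym D l = -1


open scoped Topology ArithmeticFunction.Moebius

noncomputable section

open Classical in
/-- The number of `n ∈ A` with `n < x`. -/
def countBelow (A : Set ℕ) (x : ℝ) : ℕ := #{n ∈ range ⌈x⌉₊ | n ∈ A}

/-- The set `A` has natural density `δ`. -/
def HasDensity (A : Set ℕ) (δ : ℝ) : Prop :=
  Tendsto (fun x : ℝ => (countBelow A x : ℝ) / x) atTop (𝓝 δ)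

theorem countBelow_eq_zero {A : Set ℕ} {x : ℝ} (h : ∀ n : ℕ, n < ⌈x⌉₊ → n ∉ A) :
    countBelow A x = 0 := by
  classical
  unfold countBelow
  rw [card_eq_zero, filter_eq_empty_iff]
  exact fun n hn => h n (mem_range.1 hn)

theorem HasDensity.biUnion {ι : Type*} {t : Finset ι} {A : ι → Set ℕ} {δ : ι → ℝ}
    (hA : (t : Set ι).PairwiseDisjoint A) (h : ∀ i ∈ t, HasDensity (A i) (δ i)) :
    HasDensity (⋃ i ∈ t, A i) (∑ i ∈ t, δ i) := by
  classical
  refine (tendsto_finsetSum t h).congr fun x => ?_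
  rw [← Finset.sum_div, ← Nat.cast_sum]
  congr 2
  unfold countBelow
  rw [← Finset.card_biUnion]
  · congr 1
    ext n
    simp only [mem_biUnion, mem_filter, Set.mem_iUnion, exists_prop]
    tauto
  · intro i hi j hj hij
    rw [Function.onFun, Finset.disjoint_left]
    intro n hn hn'
    exact Set.disjoint_left.1 (hA hi hj hij) (mem_filter.1 hn).2 (mem_filter.1 hn').2

theorem HasDensity.union {A B : Set ℕ} {α β : ℝ} (hA : HasDensity A α) (hB : HasDensity B β)
    (hAB : Disjoint A B) : HasDensity (A ∪ B) (α + β) := by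
  have := HasDensity.biUnion (t := univ) (A := fun b : Bool => cond b A B)
    (δ := fun b : Bool => cond b α β)
    (by
      intro i _ j _ hij
      cases i <;> cases j <;> simp_all [Function.onFun, disjoint_comm])
    (by rintro (_ | _) - <;> assumption)
  simpa [Set.union_eq_iUnion] using this

theorem countBelow_image_mul {m : ℕ} (hm : 0 < m) (A : Set ℕ) (x : ℝ) :
    countBelow ((fun n => m * n) '' A) x = countBelow A (x / m) := by
  classical
  have hm' : (0 : ℝ) < m := by exact_mod_cast hm
  unfold countBelow
  rw [← Finset.card_image_of_injective {n ∈ range ⌈x / m⌉₊ | n ∈ A}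
    (mul_right_injective₀ hm.ne')]
  congr 1
  ext n
  simp only [mem_filter, mem_range, Nat.lt_ceil, Set.mem_image, Finset.mem_image, lt_div_iff₀ hm']
  constructor
  · rintro ⟨hn, a, ha, rfl⟩
    exact ⟨a, ⟨by push_cast at hn; linarith, ha⟩, rfl⟩
  · rintro ⟨a, ⟨hn, ha⟩, rfl⟩
    exact ⟨by push_cast; linarith, a, ha, rfl⟩

theorem HasDensity.image_mul {A : Set ℕ} {δ : ℝ} (hA : HasDensity A δ) {m : ℕ} (hm : 0 < m) :
    HasDensity ((fun n => m * n) '' A) (δ / m) := by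
  have hm' : (0 : ℝ) < m := by exact_mod_cast hm
  refine ((hA.comp (tendsto_id.atTop_div_const hm')).div_const (m : ℝ)).congr fun x => ?_
  simp only [Function.comp_apply, id_eq, countBelow_image_mul hm]
  field_simp

theorem countBelow_modEq_le {m : ℕ} (hm : 0 < m) (c : ℕ) {x : ℝ} (hx : 0 < x) :
    |(countBelow {n | n ≡ c [MOD m]} x : ℝ) - x / m| ≤ 2 := by
  classical
  have hm' : (0 : ℝ) < m := by exact_mod_cast hm
  have h1 : countBelow {n | n ≡ c [MOD m]} x
      = ⌈x⌉₊ / m + if c % m < ⌈x⌉₊ % m then 1 else 0 := by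
    rw [← Nat.count_modEq_card _ hm, Nat.count_eq_card_filter_range]
    unfold countBelow
    congr 1
    ext; simp
  have h2 : (⌈x⌉₊ : ℝ) = m * (⌈x⌉₊ / m : ℕ) + (⌈x⌉₊ % m : ℕ) := by
    exact_mod_cast (Nat.div_add_mod _ _).symm
  have h3 : ((⌈x⌉₊ % m : ℕ) : ℝ) + 1 ≤ m := by exact_mod_cast Nat.mod_lt _ hm
  have h4 := Nat.le_ceil x
  have h5 := Nat.ceil_lt_add_one hx.le
  have h6 : (0 : ℝ) ≤ (⌈x⌉₊ % m : ℕ) := by positivity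
  have h7 : (1 : ℝ) ≤ m := by exact_mod_cast hm
  set k : ℝ := ((⌈x⌉₊ / m : ℕ) : ℝ)
  have h8 : x / m ≤ k + 1 := by rw [div_le_iff₀ hm']; nlinarith
  have h9 : k - 1 ≤ x / m := by rw [le_div_iff₀ hm']; nlinarith
  rw [h1, abs_le]
  push_cast
  split_ifs <;> constructor <;> linarith

theorem hasDensity_modEq {m : ℕ} (hm : 0 < m) (c : ℕ) :
    HasDensity {n | n ≡ c [MOD m]} (1 / m) := by
  rw [HasDensity, tendsto_iff_norm_sub_tendsto_zero]
  refine squeeze_zero' (Eventually.of_forall fun _ => norm_nonneg _) ?_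
    (tendsto_const_nhds.div_atTop tendsto_id : Tendsto (fun x : ℝ => 2 / x) atTop (𝓝 0))
  filter_upwards [eventually_gt_atTop 0] with x hx
  have : (countBelow {n | n ≡ c [MOD m]} x : ℝ) / x - 1 / m
      = ((countBelow {n | n ≡ c [MOD m]} x : ℝ) - x / m) / x := by field_simp
  rw [this, Real.norm_eq_abs, abs_div, abs_of_pos hx]
  gcongr
  exact countBelow_modEq_le hm c hx

theorem dvd_of_sq_dvd_sq_mul {d b s : ℕ} (hb : b ≠ 0) (hs : Squarefree s)
    (h : d ^ 2 ∣ b ^ 2 * s) : d ∣ b := by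
  have hg : 0 < d.gcd b := Nat.gcd_pos_of_pos_right _ (Nat.pos_of_ne_zero hb)
  obtain ⟨g, d', b', hg', hco, rfl, rfl⟩ := Nat.exists_coprime' hg
  have h1 : d' ^ 2 ∣ b' ^ 2 * s := by
    refine Nat.dvd_of_mul_dvd_mul_left (pow_pos hg' 2) ?_
    convert h using 1 <;> ring
  have h2 : d' * d' ∣ s := by
    rw [← sq]; exact (hco.pow 2 2).dvd_of_dvd_mul_left h1
  have : d' = 1 := Nat.isUnit_iff.1 (hs d' h2)
  simp [this]

theorem sum_moebius_divisors (n : ℕ) :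
    ∑ d ∈ n.divisors, μ d = if n = 1 then 1 else 0 := by
  rw [← ArithmeticFunction.coe_mul_zeta_apply, ArithmeticFunction.moebius_mul_coe_zeta,
    ArithmeticFunction.one_apply]

theorem sum_moebius_sq_dvd {n X : ℕ} (hn : n ≠ 0) (hX : n < X) :
    ∑ d ∈ range X, (if d ^ 2 ∣ n then μ d else 0) = if Squarefree n then 1 else 0 := by
  obtain ⟨s, b, rfl, hs⟩ := Nat.sq_mul_squarefree n
  have hb : b ≠ 0 := by rintro rfl; simp at hn
  have hs0 : s ≠ 0 := hs.ne_zero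
  have h1 : {d ∈ range X | d ^ 2 ∣ b ^ 2 * s} = b.divisors := by
    ext d
    simp only [mem_filter, mem_range, Nat.mem_divisors]
    constructor
    · rintro ⟨-, h⟩
      exact ⟨dvd_of_sq_dvd_sq_mul hb hs h, hb⟩
    · rintro ⟨h, -⟩
      refine ⟨?_, (pow_dvd_pow_of_dvd h 2).trans (Dvd.intro _ rfl)⟩
      calc d ≤ b := Nat.le_of_dvd (Nat.pos_of_ne_zero hb) h
        _ ≤ b ^ 2 := Nat.le_self_pow two_ne_zero _
        _ ≤ b ^ 2 * s := Nat.le_mul_of_pos_right _ (Nat.pos_of_ne_zero hs0)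
        _ < X := hX
  rw [← sum_filter, h1, sum_moebius_divisors]
  congr 1
  refine propext ⟨?_, fun h => ?_⟩
  · rintro rfl; simpa using hs
  · exact Nat.isUnit_iff.1 (h b ⟨s, by ring⟩)

/-- The sum of `μ(d) / d²` over `d` coprime to `M`. -/
def coprimeMoebiusSum (M : ℕ) : ℝ := ∑' d : ℕ, if d.Coprime M then (μ d : ℝ) / d ^ 2 else 0

theorem abs_moebius_div_sq_le (d : ℕ) : |(μ d : ℝ) / d ^ 2| ≤ 1 / (d : ℝ) ^ 2 := by
  rw [abs_div, abs_of_nonneg (by positivity : (0 : ℝ) ≤ (d : ℝ) ^ 2)]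
  gcongr
  exact_mod_cast ArithmeticFunction.abs_moebius_le_one

theorem summable_ite_moebius (P : ℕ → Prop) [DecidablePred P] :
    Summable fun d : ℕ => if P d then (μ d : ℝ) / d ^ 2 else 0 := by
  refine Summable.of_norm_bounded (Real.summable_one_div_nat_pow.2 one_lt_two) fun d => ?_
  split_ifs
  · exact abs_moebius_div_sq_le d
  · rw [norm_zero]; positivity

theorem coprimeMoebiusSum_pos (M : ℕ) : 0 < coprimeMoebiusSum M := by
  have h := hasSum_le (fun d : ℕ => ?_) (hasSum_ite_eq 1 (2 : ℝ))
    ((summable_ite_moebius fun d => d.Coprime M).hasSum.add hasSum_zeta_two)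
  · have h2 : Real.pi < 3.15 := Real.pi_lt_d2
    have h3 := Real.pi_pos
    change 2 ≤ coprimeMoebiusSum M + _ at h
    nlinarith
  · have := abs_le.1 (abs_moebius_div_sq_le d)
    by_cases hd : d = 1
    · subst hd; norm_num
    · rw [if_neg hd]
      split_ifs
      · linarith
      · positivity

theorem coprimeMoebiusSum_congr {M M' : ℕ} (h : ∀ d : ℕ, d.Coprime M ↔ d.Coprime M') :
    coprimeMoebiusSum M = coprimeMoebiusSum M' := by
  simp only [coprimeMoebiusSum, h]

theorem coprimeMoebiusSum_mul_prime {M l : ℕ} (hl : l.Prime) (hM : ¬ l ∣ M) :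
    coprimeMoebiusSum M = coprimeMoebiusSum (M * l) * (1 - 1 / (l : ℝ) ^ 2) := by
  have hl0 : (l : ℝ) ≠ 0 := by exact_mod_cast hl.ne_zero
  have hlM : l.Coprime M := (Nat.Prime.coprime_iff_not_dvd hl).2 hM
  have h1 : coprimeMoebiusSum M = coprimeMoebiusSum (M * l) +
      ∑' d : ℕ, if d.Coprime M ∧ l ∣ d then (μ d : ℝ) / d ^ 2 else 0 := by
    unfold coprimeMoebiusSum
    rw [← (summable_ite_moebius _).tsum_add (summable_ite_moebius _)]
    congr 1
    ext d
    have : d.Coprime (M * l) ↔ d.Coprime M ∧ ¬ l ∣ d := by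
      rw [Nat.coprime_mul_iff_right, Nat.coprime_comm (n := d) (m := l),
        Nat.Prime.coprime_iff_not_dvd hl]
    by_cases h2 : d.Coprime M <;> by_cases h3 : l ∣ d <;> simp [this, h2, h3]
  have h2 : (∑' d : ℕ, if d.Coprime M ∧ l ∣ d then (μ d : ℝ) / d ^ 2 else 0)
      = - (1 / (l : ℝ) ^ 2) * coprimeMoebiusSum (M * l) := by
    rw [coprimeMoebiusSum, ← tsum_mul_left,
      ← (mul_right_injective₀ hl.ne_zero).tsum_eq (f := fun d : ℕ =>
        if d.Coprime M ∧ l ∣ d then (μ d : ℝ) / d ^ 2 else 0)]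
    · congr 1
      ext e
      have h6 : (l * e).Coprime M ↔ e.Coprime M :=
        Nat.coprime_mul_iff_left.trans (and_iff_right hlM)
      simp only [h6, dvd_mul_right, and_true, Nat.coprime_mul_iff_right (k := e)]
      by_cases h3 : e.Coprime M
      · by_cases h4 : e.Coprime l
        · have : μ (l * e) = - μ e := by
            rw [ArithmeticFunction.isMultiplicative_moebius.map_mul_of_coprime h4.symm,
              ArithmeticFunction.moebius_apply_prime hl]
            ring
          rw [if_pos h3, if_pos ⟨h3, h4⟩, this]
          push_cast
          field_simp
        · have : μ (l * e) = 0 := by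
            apply ArithmeticFunction.moebius_eq_zero_of_not_squarefree
            intro h5
            exact h4 (Nat.coprime_of_squarefree_mul h5).symm
          simp [h4, this]
      · simp [h3]
    · intro d hd
      have : d.Coprime M ∧ l ∣ d := by
        by_contra h; simp [h] at hd
      obtain ⟨e, rfl⟩ := this.2
      exact ⟨e, rfl⟩
  rw [h1, h2]
  ring

theorem countBelow_sq_dvd_le {d : ℕ} {A : Set ℕ} (hA : ∀ n ∈ A, n ≠ 0 ∧ d ^ 2 ∣ n)
    {x : ℝ} (hx : 0 < x) : (countBelow A x : ℝ) / x ≤ 1 / (d : ℝ) ^ 2 := by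
  classical
  rcases Nat.eq_zero_or_pos d with rfl | hd
  · have : countBelow A x = 0 := by
      unfold countBelow
      rw [card_eq_zero, filter_eq_empty_iff]
      intro n _ hn
      have := hA n hn
      simp at this
    simp [this]
  have hX : 0 < ⌈x⌉₊ := Nat.ceil_pos.2 hx
  have h1 : countBelow A x ≤ (⌈x⌉₊ - 1) / d ^ 2 := by
    rw [← Nat.Ioc_filter_dvd_card_eq_div]
    apply card_le_card
    intro n hn
    rw [mem_filter, mem_range] at hn
    have := hA n hn.2
    rw [mem_filter, mem_Ioc]
    exact ⟨⟨by omega, by omega⟩, this.2⟩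
  have h2 : (countBelow A x : ℝ) * d ^ 2 ≤ x := by
    have h3 : countBelow A x * d ^ 2 ≤ ⌈x⌉₊ - 1 := (Nat.le_div_iff_mul_le (by positivity)).1 h1
    have h4 : countBelow A x * d ^ 2 + 1 ≤ ⌈x⌉₊ := by omega
    have h5 : (countBelow A x : ℝ) * d ^ 2 + 1 ≤ ⌈x⌉₊ := by exact_mod_cast h4
    linarith [Nat.ceil_lt_add_one hx.le]
  have hd' : (0 : ℝ) < d := by exact_mod_cast hd
  rw [div_le_div_iff₀ hx (by positivity)]
  linarith

theorem countBelow_squarefree_modEq {M a : ℕ} (hM : 1 < M) (ha : a.Coprime M) (x : ℝ) :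
    (countBelow {n | Squarefree n ∧ n ≡ a [MOD M]} x : ℝ)
      = ∑' d : ℕ, (μ d : ℝ) * countBelow {n | n ≡ a [MOD M] ∧ d ^ 2 ∣ n} x := by
  classical
  have hne : ∀ n, n ≡ a [MOD M] → n ≠ 0 := by
    rintro _ h rfl
    have : M ∣ a := (Nat.modEq_zero_iff_dvd).1 h.symm
    exact hM.ne' (Nat.eq_one_of_dvd_coprimes ha this dvd_rfl)
  rw [tsum_eq_sum (s := range ⌈x⌉₊)]
  · unfold countBelow
    simp only [card_filter, Set.mem_ofPred_eq]
    push_cast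
    simp only [mul_sum]
    rw [sum_comm]
    refine sum_congr rfl fun n hn => ?_
    by_cases h : n ≡ a [MOD M]
    · have := sum_moebius_sq_dvd (hne n h) (mem_range.1 hn)
      simp only [h, true_and, and_true, mul_ite, mul_one, mul_zero]
      have h2 := congrArg (Int.cast : ℤ → ℝ) this
      push_cast at h2
      exact h2.symm
    · simp [h]
  · intro d hd
    rw [mem_range, not_lt] at hd
    have : countBelow {n | n ≡ a [MOD M] ∧ d ^ 2 ∣ n} x = 0 := by
      refine countBelow_eq_zero ?_
      rintro n hn ⟨h1, h2⟩
      have := Nat.le_of_dvd (Nat.pos_of_ne_zero (hne n h1)) h2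
      have := Nat.le_self_pow two_ne_zero d
      omega
    simp [this]

theorem hasDensity_modEq_sq_dvd {M a d : ℕ} (hM : 1 < M) (ha : a.Coprime M) (hd : d ≠ 0) :
    HasDensity {n | n ≡ a [MOD M] ∧ d ^ 2 ∣ n}
      (if d.Coprime M then 1 / (M * (d : ℝ) ^ 2) else 0) := by
  classical
  split_ifs with h
  · have hco : M.Coprime (d ^ 2) := (h.pow_left 2).symm
    have key := hasDensity_modEq (m := M * d ^ 2) (by positivity)
      (Nat.chineseRemainder hco a 0 : ℕ)
    push_cast at key
    convert key using 1
    ext n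
    have hc := (Nat.chineseRemainder hco a 0).2
    rw [Set.mem_ofPred_eq, Set.mem_ofPred_eq, ← Nat.modEq_and_modEq_iff_modEq_mul hco,
      ← Nat.modEq_zero_iff_dvd]
    exact ⟨fun h => ⟨h.1.trans hc.1.symm, h.2.trans hc.2.symm⟩,
      fun h => ⟨h.1.trans hc.1, h.2.trans hc.2⟩⟩
  · have : {n | n ≡ a [MOD M] ∧ d ^ 2 ∣ n} = ∅ := by
      ext n
      simp only [Set.mem_ofPred_eq, Set.mem_empty_iff_false, iff_false, not_and]
      intro h1 h2
      obtain ⟨l, hl, hld, hlM⟩ := Nat.Prime.not_coprime_iff_dvd.1 h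
      have h3 : l ∣ a := (h1.dvd_iff hlM).1 ((dvd_pow hld two_ne_zero).trans h2)
      exact hl.one_lt.ne' (Nat.eq_one_of_dvd_coprimes ha h3 hlM)
    rw [this]
    refine tendsto_const_nhds.congr fun x => ?_
    simp [countBelow_eq_zero]

theorem hasDensity_squarefree_modEq {M a : ℕ} (hM : 1 < M) (ha : a.Coprime M) :
    HasDensity {n | Squarefree n ∧ n ≡ a [MOD M]} (coprimeMoebiusSum M / M) := by
  have hne : ∀ n, n ≡ a [MOD M] → n ≠ 0 := by
    rintro _ h rfl
    have : M ∣ a := (Nat.modEq_zero_iff_dvd).1 h.symm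
    exact hM.ne' (Nat.eq_one_of_dvd_coprimes ha this dvd_rfl)
  have hlim := tendsto_tsum_of_dominated_convergence (𝓕 := (atTop : Filter ℝ))
    (f := fun x d => (μ d : ℝ) * (countBelow {n | n ≡ a [MOD M] ∧ d ^ 2 ∣ n} x / x))
    (g := fun d : ℕ => if d.Coprime M then (μ d : ℝ) / d ^ 2 / M else 0)
    (bound := fun d => 1 / (d : ℝ) ^ 2) (Real.summable_one_div_nat_pow.2 one_lt_two) ?_ ?_
  · have h1 : coprimeMoebiusSum M / M
        = ∑' d : ℕ, if d.Coprime M then (μ d : ℝ) / d ^ 2 / M else 0 := by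
      rw [coprimeMoebiusSum, ← tsum_div_const]
      congr 1
      ext d
      split_ifs <;> simp
    rw [h1]
    refine hlim.congr fun x => ?_
    rw [countBelow_squarefree_modEq hM ha, ← tsum_div_const]
    simp only [mul_div_assoc]
  · intro d
    rcases eq_or_ne d 0 with rfl | hd
    · simp
    · convert (hasDensity_modEq_sq_dvd hM ha hd).const_mul (μ d : ℝ) using 2
      split_ifs
      · field_simp
      · simp
  · filter_upwards [eventually_gt_atTop 0] with x hx d
    rw [norm_mul]
    have h1 : ‖(μ d : ℝ)‖ ≤ 1 := by
      rw [Real.norm_eq_abs]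
      exact_mod_cast ArithmeticFunction.abs_moebius_le_one
    have h2 : ‖(countBelow {n | n ≡ a [MOD M] ∧ d ^ 2 ∣ n} x : ℝ) / x‖ ≤ 1 / (d : ℝ) ^ 2 := by
      rw [Real.norm_of_nonneg (by positivity)]
      exact countBelow_sq_dvd_le (fun n hn => ⟨hne n hn.1, hn.2⟩) hx
    calc _ ≤ 1 * (1 / (d : ℝ) ^ 2) := by gcongr
      _ = _ := one_mul _

theorem card_quadraticChar_mul_eq {l : ℕ} [Fact l.Prime] (hl2 : l ≠ 2) {c : ZMod l} (hc : c ≠ 0)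
    {ε : ℤ} (hε : ε = 1 ∨ ε = -1) :
    (#{b : ZMod l | quadraticChar (ZMod l) (c * b) = ε} : ℝ) = (l - 1) / 2 := by
  have hsum : ∑ b : ZMod l, quadraticChar (ZMod l) (c * b) = 0 := by
    simp only [map_mul, ← mul_sum]
    rw [quadraticChar_sum_zero (by rwa [ZMod.ringChar_zmod_n]), mul_zero]
  have hpt : ∀ b : ZMod l, 2 * (if quadraticChar (ZMod l) (c * b) = ε then 1 else 0 : ℤ)
      = (1 - if b = 0 then 1 else 0) + ε * quadraticChar (ZMod l) (c * b) := by
    intro b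
    rcases eq_or_ne b 0 with rfl | hb
    · rcases hε with rfl | rfl <;> simp
    · rcases quadraticChar_dichotomy (mul_ne_zero hc hb) with h | h <;>
        rcases hε with rfl | rfl <;> simp [h, hb]
  have h2 : 2 * (#{b : ZMod l | quadraticChar (ZMod l) (c * b) = ε} : ℤ) = l - 1 := by
    rw [card_filter]
    push_cast
    rw [mul_sum, sum_congr rfl fun b _ => hpt b, sum_add_distrib, sum_sub_distrib, ← mul_sum, hsum]
    simp
  have h3 : 2 * (#{b : ZMod l | quadraticChar (ZMod l) (c * b) = ε} : ℝ) = l - 1 := by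
    exact_mod_cast h2
  linarith

/-- Squarefree integers in a residue class coprime to `M` with prescribed Jacobi symbols. -/
theorem hasDensity_squarefree_modEq_jacobiSym {L : Finset ℕ} (hL : ∀ l ∈ L, l.Prime ∧ l ≠ 2)
    {c : ℤ} (hc : ∀ l ∈ L, ¬ (l : ℤ) ∣ c) {ε : ℕ → ℤ} (hε : ∀ l, ε l = 1 ∨ ε l = -1)
    {M a : ℕ} (hM : 1 < M) (ha : a.Coprime M) (hLM : ∀ l ∈ L, ¬ l ∣ M) :
    HasDensity {n | (Squarefree n ∧ n ≡ a [MOD M]) ∧ ∀ l ∈ L, jacobiSym (c * n) l = ε l}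
      (coprimeMoebiusSum M / M * ∏ l ∈ L, (l : ℝ) / (2 * (l + 1))) := by
  induction L using Finset.induction_on generalizing M a with
  | empty => simpa using hasDensity_squarefree_modEq hM ha
  | insert l L hlL ih =>
    simp only [forall_mem_insert] at hL hc hLM
    obtain ⟨⟨hl, hl2⟩, hL⟩ := hL
    have : Fact l.Prime := ⟨hl⟩
    have hMl : M.Coprime l := ((Nat.Prime.coprime_iff_not_dvd hl).2 hLM.1).symm
    have hc0 : ((c : ℤ) : ZMod l) ≠ 0 := by
      rw [Ne, ZMod.intCast_zmod_eq_zero_iff_dvd]; exact hc.1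
    let t : Finset (ZMod l) := {b | quadraticChar (ZMod l) (c * b) = ε l}
    let crt : ZMod l → ℕ := fun b => Nat.chineseRemainder hMl a b.val
    have hcrt : ∀ (b : ZMod l) (n : ℕ),
        n ≡ crt b [MOD M * l] ↔ n ≡ a [MOD M] ∧ (n : ZMod l) = b := by
      intro b n
      have h := (Nat.chineseRemainder hMl a b.val).2
      rw [← Nat.modEq_and_modEq_iff_modEq_mul hMl]
      have h1 : n ≡ crt b [MOD l] ↔ (n : ZMod l) = b := by
        rw [← ZMod.natCast_eq_natCast_iff, (ZMod.natCast_eq_natCast_iff _ _ _).2 h.2,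
          ZMod.natCast_zmod_val]
      rw [h1]
      exact and_congr_left fun _ => ⟨fun h' => h'.trans h.1, fun h' => h'.trans h.1.symm⟩
    have hjac : ∀ n : ℕ, jacobiSym (c * n) l = quadraticChar (ZMod l) (c * (n : ZMod l)) := by
      intro n
      rw [← jacobiSym.legendreSym.to_jacobiSym, legendreSym]
      push_cast
      rfl
    have key := HasDensity.biUnion (t := t)
      (A := fun b => {n | (Squarefree n ∧ n ≡ crt b [MOD M * l]) ∧
        ∀ l' ∈ L, jacobiSym (c * n) l' = ε l'})
      (δ := fun _ => coprimeMoebiusSum (M * l) / (M * l : ℕ) *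
        ∏ l ∈ L, (l : ℝ) / (2 * (l + 1))) ?_ ?_
    · have hset : (⋃ b ∈ t, {n : ℕ | (Squarefree n ∧ n ≡ crt b [MOD M * l]) ∧
          ∀ l' ∈ L, jacobiSym (c * n) l' = ε l'}) = {n : ℕ | (Squarefree n ∧ n ≡ a [MOD M]) ∧
            ∀ l' ∈ insert l L, jacobiSym (c * n) l' = ε l'} := by
        ext n
        simp only [Set.mem_iUnion, Set.mem_ofPred_eq, exists_prop, forall_mem_insert, hcrt, hjac,
          t, mem_filter, Finset.mem_univ, true_and]
        constructor
        · rintro ⟨b, hb, ⟨h1, h2, rfl⟩, h3⟩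
          exact ⟨⟨h1, h2⟩, hb, h3⟩
        · rintro ⟨⟨h1, h2⟩, hb, h3⟩
          exact ⟨n, hb, ⟨h1, h2, rfl⟩, h3⟩
      rw [hset] at key
      convert key using 1
      have hcard : (#t : ℝ) = (l - 1) / 2 := card_quadraticChar_mul_eq hl2 hc0 (hε l)
      have hl1 : (1 : ℝ) < l := by exact_mod_cast hl.one_lt
      have hM' : (M : ℝ) ≠ 0 := by positivity
      rw [sum_const, nsmul_eq_mul, hcard, prod_insert hlL, coprimeMoebiusSum_mul_prime hl hLM.1]
      push_cast
      have : (l : ℝ) + 1 ≠ 0 := by positivity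
      have : (l : ℝ) ≠ 0 := by positivity
      field_simp
      ring
    · intro b _ b' _ hbb'
      rw [Function.onFun, Set.disjoint_left]
      rintro n ⟨⟨_, h1⟩, _⟩ ⟨⟨_, h2⟩, _⟩
      exact hbb' (((hcrt _ _).1 h1).2.symm.trans ((hcrt _ _).1 h2).2)
    · intro b hb
      refine ih hL hc.2 ?_ ?_ ?_
      · exact hM.trans_le (Nat.le_mul_of_pos_right _ hl.pos)
      · obtain ⟨h1, h2⟩ := (hcrt b (crt b)).1 rfl
        refine Nat.Coprime.mul_right ?_ ?_
        · rw [Nat.Coprime, h1.gcd_eq]; exact ha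
        · rw [Nat.coprime_comm, Nat.Prime.coprime_iff_not_dvd hl,
            ← ZMod.natCast_eq_zero_iff, h2]
          rintro rfl
          have h3 := (mem_filter.1 hb).2
          rw [mul_zero, quadraticChar_zero] at h3
          rcases hε l with h | h <;> simp [h] at h3
      · intro l' hl' h
        rcases (hL l' hl').1.dvd_mul.1 h with h | h
        · exact hLM.2 l' hl' h
        · exact hlL ((Nat.prime_dvd_prime_iff_eq (hL l' hl').1 hl).1 h ▸ hl')

theorem isNegFundDisc_neg_natCast (n : ℕ) : IsNegFundDisc (-(n : ℤ)) ↔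
    (Squarefree n ∧ n ≡ 3 [MOD 4]) ∨ (∃ m, 4 * m = n ∧ Squarefree m ∧ m ≡ 1 [MOD 4]) ∨
      ∃ m, 8 * m = n ∧ Squarefree m ∧ m ≡ 1 [MOD 2] := by
  have hsq : ∀ m : ℕ, Squarefree (-(m : ℤ)) ↔ Squarefree m := fun m => by
    rw [← Int.squarefree_natAbs, Int.natAbs_neg, Int.natAbs_natCast]
  have hsq2 : ∀ m : ℕ, m % 2 = 1 → (Squarefree (2 * m) ↔ Squarefree m) := fun m hm => by
    rw [Nat.squarefree_mul ((Nat.coprime_two_left).2 (Nat.odd_iff.2 hm))]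
    exact and_iff_right Nat.prime_two.squarefree
  simp only [Nat.ModEq, IsNegFundDisc]
  constructor
  · rintro ⟨hn, ⟨h4, h⟩ | ⟨d, hd, h, h4⟩⟩
    · exact Or.inl ⟨(hsq n).1 h, by omega⟩
    · obtain ⟨m, rfl⟩ : ∃ m : ℕ, d = -(m : ℤ) := ⟨d.natAbs, by omega⟩
      rw [hsq] at h
      rcases h4 with h4 | h4
      · obtain ⟨m', rfl⟩ : ∃ m', m = 2 * m' := ⟨m / 2, by omega⟩
        have h2 : m' % 2 = 1 := by omega
        exact Or.inr (Or.inr ⟨m', by omega, (hsq2 m' h2).1 h, h2⟩)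
      · exact Or.inr (Or.inl ⟨m, by omega, h, by omega⟩)
  · rintro (⟨h, h4⟩ | ⟨m, rfl, h, h4⟩ | ⟨m, rfl, h, h2⟩)
    · exact ⟨by omega, Or.inl ⟨by omega, (hsq n).2 h⟩⟩
    · exact ⟨by omega, Or.inr ⟨-m, by push_cast; ring, (hsq m).2 h, by omega⟩⟩
    · exact ⟨by omega, Or.inr ⟨-(2 * m : ℕ), by push_cast; ring, (hsq _).2 ((hsq2 m h2).2 h),
        by omega⟩⟩

theorem coprimeMoebiusSum_two_pow {k : ℕ} (hk : k ≠ 0) :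
    coprimeMoebiusSum (2 ^ k) = coprimeMoebiusSum 2 :=
  coprimeMoebiusSum_congr fun d => Nat.coprime_pow_right_iff (Nat.pos_of_ne_zero hk) d 2

theorem hasDensity_isNegFundDisc_jacobiSym {L : Finset ℕ} (hL : ∀ l ∈ L, l.Prime ∧ l ≠ 2)
    {ε : ℕ → ℤ} (hε : ∀ l, ε l = 1 ∨ ε l = -1) :
    HasDensity {n : ℕ | IsNegFundDisc (-n) ∧ ∀ l ∈ L, jacobiSym (-n) l = ε l}
      (3 / 8 * coprimeMoebiusSum 2 * ∏ l ∈ L, (l : ℝ) / (2 * (l + 1))) := by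
  have hpow : ∀ k : ℕ, ∀ l ∈ L, ¬ l ∣ 2 ^ k := fun k l hl h =>
    (hL l hl).2 ((Nat.prime_dvd_prime_iff_eq (hL l hl).1 Nat.prime_two).1
      ((hL l hl).1.dvd_of_dvd_pow h))
  have hc : ∀ k : ℕ, ∀ l ∈ L, ¬ (l : ℤ) ∣ -2 ^ k := fun k l hl h =>
    hpow k l hl (by rw [dvd_neg] at h; exact_mod_cast h)
  have h1 := hasDensity_squarefree_modEq_jacobiSym hL (hc 0) hε (M := 2 ^ 2) (a := 3)
    (by norm_num) (by norm_num) (hpow 2)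
  have h2 := (hasDensity_squarefree_modEq_jacobiSym hL (hc 2) hε (M := 2 ^ 2) (a := 1)
    (by norm_num) (by norm_num) (hpow 2)).image_mul (m := 4) (by norm_num)
  have h3 := (hasDensity_squarefree_modEq_jacobiSym hL (hc 3) hε (M := 2 ^ 1) (a := 1)
    (by norm_num) (by norm_num) (hpow 1)).image_mul (m := 8) (by norm_num)
  have h := (h1.union h2 ?_).union h3 ?_
  · rw [coprimeMoebiusSum_two_pow two_ne_zero, coprimeMoebiusSum_two_pow one_ne_zero] at h
    convert h using 1
    · ext n
      simp only [Set.mem_ofPred_eq, Set.mem_union, Set.mem_image, isNegFundDisc_neg_natCast]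
      norm_num only
      constructor
      · rintro ⟨h | ⟨m, rfl, h⟩ | ⟨m, rfl, h⟩, hj⟩
        · exact Or.inl (Or.inl ⟨h, by simpa using hj⟩)
        · exact Or.inl (Or.inr ⟨m, ⟨h, by simpa using hj⟩, rfl⟩)
        · exact Or.inr ⟨m, ⟨h, by simpa using hj⟩, rfl⟩
      · rintro ((⟨h, hj⟩ | ⟨m, ⟨h, hj⟩, rfl⟩) | ⟨m, ⟨h, hj⟩, rfl⟩)
        · exact ⟨Or.inl h, by simpa using hj⟩
        · exact ⟨Or.inr (Or.inl ⟨m, rfl, h⟩), by simpa using hj⟩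
        · exact ⟨Or.inr (Or.inr ⟨m, rfl, h⟩), by simpa using hj⟩
    · push_cast
      ring
  · rw [Set.disjoint_left]
    rintro n ⟨⟨_, h1⟩, _⟩ ⟨m, _, rfl⟩
    simp only [Nat.ModEq] at h1
    omega
  · rw [Set.disjoint_left]
    rintro n (⟨⟨_, h1⟩, _⟩ | ⟨m', ⟨⟨_, h1⟩, _⟩, rfl⟩) ⟨m, _, h2⟩ <;>
    simp only [Nat.ModEq] at h1 h2 <;>
    omega

theorem hasDensity_isNegFundDisc_modEq_jacobiSym {L : Finset ℕ}
    (hL : ∀ l ∈ L, l.Prime ∧ l ≠ 2) {ε : ℕ → ℤ} (hε : ∀ l, ε l = 1 ∨ ε l = -1)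
    {a : ℕ} (ha : a % 4 = 3) :
    HasDensity {n : ℕ | IsNegFundDisc (-n) ∧ n ≡ a [MOD 8] ∧ ∀ l ∈ L, jacobiSym (-n) l = ε l}
      (1 / 8 * coprimeMoebiusSum 2 * ∏ l ∈ L, (l : ℝ) / (2 * (l + 1))) := by
  have hpow : ∀ k : ℕ, ∀ l ∈ L, ¬ l ∣ 2 ^ k := fun k l hl h =>
    (hL l hl).2 ((Nat.prime_dvd_prime_iff_eq (hL l hl).1 Nat.prime_two).1
      ((hL l hl).1.dvd_of_dvd_pow h))
  have hc : ∀ l ∈ L, ¬ (l : ℤ) ∣ -1 := fun l hl h =>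
    hpow 0 l hl (by rw [dvd_neg] at h; exact_mod_cast h)
  have h := hasDensity_squarefree_modEq_jacobiSym hL hc hε (M := 2 ^ 3) (a := a)
    (by norm_num) (Nat.Coprime.pow_right 3 (Nat.coprime_two_right.2 (Nat.odd_iff.2 (by omega))))
    (hpow 3)
  rw [coprimeMoebiusSum_two_pow three_ne_zero] at h
  convert h using 1
  · ext n
    simp only [Set.mem_ofPred_eq, isNegFundDisc_neg_natCast, neg_one_mul, ← and_assoc]
    refine and_congr_left fun _ => and_congr_left fun h8 => ?_
    simp only [Nat.ModEq] at *
    constructor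
    · rintro (h | ⟨m, ⟨rfl, -⟩, -⟩ | ⟨m, ⟨rfl, -⟩, -⟩)
      · exact h.1
      · omega
      · omega
    · exact fun h => Or.inl ⟨h, by omega⟩
  · push_cast
    ring

/-- Negative fundamental discriminants with prescribed splitting behaviour (inert at the primes
of `T`, split at the others) at a finite set `L` of primes. -/
theorem hasDensity_isNegFundDisc_splitting {L : Finset ℕ} (hL : ∀ l ∈ L, l.Prime)
    (T : Finset ℕ) :
    HasDensity {n : ℕ | IsNegFundDisc (-n) ∧
        ∀ l ∈ L, if l ∈ T then InertIn l (-n) else SplitsIn l (-n)}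
      (3 / 8 * coprimeMoebiusSum 2 * ∏ l ∈ L, (l : ℝ) / (2 * (l + 1))) := by
  set ε : ℕ → ℤ := fun l => if l ∈ T then -1 else 1
  have hε : ∀ l, ε l = 1 ∨ ε l = -1 := fun l => by
    by_cases h : l ∈ T <;> simp [ε, h]
  have hodd : ∀ (l n : ℕ), l ≠ 2 →
      ((if l ∈ T then InertIn l (-n) else SplitsIn l (-n)) ↔ jacobiSym (-n) l = ε l) := by
    intro l n hl
    by_cases h : l ∈ T <;> simp [ε, h, InertIn, SplitsIn, hl]
  have hL' : ∀ l ∈ L.erase 2, l.Prime ∧ l ≠ 2 := fun l hl =>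
    ⟨hL l (mem_of_mem_erase hl), ne_of_mem_erase hl⟩
  by_cases h2 : 2 ∈ L
  · set a : ℕ := if 2 ∈ T then 3 else 7
    have ha : a % 4 = 3 := by by_cases h : 2 ∈ T <;> simp [a, h]
    convert hasDensity_isNegFundDisc_modEq_jacobiSym hL' hε ha using 1
    · ext n
      rw [Set.mem_ofPred_eq, Set.mem_ofPred_eq, ← insert_erase h2, forall_mem_insert,
        erase_insert (notMem_erase 2 L)]
      refine and_congr_right fun _ => and_congr ?_ (forall₂_congr fun l hl =>
        hodd l n (hL' l hl).2)
      by_cases h : 2 ∈ T <;> simp only [h, a, if_true, if_false, InertIn, SplitsIn, Nat.ModEq] <;>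
        omega
    · rw [← mul_prod_erase L _ h2]
      push_cast
      ring
  · rw [erase_eq_of_notMem h2] at hL'
    convert hasDensity_isNegFundDisc_jacobiSym hL' hε using 1
    ext n
    exact and_congr_right fun _ => forall₂_congr fun l hl => hodd l n (hL' l hl).2

theorem card_int_eq_countBelow {B : Set ℤ} (hB : ∀ D ∈ B, D < 0) (x : ℝ) :
    Nat.card {D : ℤ | D ∈ B ∧ |(D : ℝ)| < x} = countBelow {n : ℕ | -(n : ℤ) ∈ B} x := by
  classical
  have h : {D : ℤ | D ∈ B ∧ |(D : ℝ)| < x} = (fun n : ℕ => -(n : ℤ)) ''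
      ↑({n ∈ range ⌈x⌉₊ | n ∈ {n : ℕ | -(n : ℤ) ∈ B}} : Finset ℕ) := by
    ext D
    simp only [Set.mem_ofPred_eq, Set.mem_image, mem_coe, mem_filter, mem_range, Nat.lt_ceil]
    constructor
    · rintro ⟨hD, hx⟩
      obtain ⟨n, rfl⟩ : ∃ n : ℕ, D = -(n : ℤ) := ⟨D.natAbs, by have := hB D hD; omega⟩
      exact ⟨n, ⟨by simpa using hx, hD⟩, rfl⟩
    · rintro ⟨n, ⟨hx, hD⟩, rfl⟩
      exact ⟨hD, by simpa using hx⟩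
  have hinj : Function.Injective fun n : ℕ => -(n : ℤ) := fun a b h => by simpa using h
  rw [h, Nat.card_coe_set_eq, Set.ncard_image_of_injective _ hinj, Set.ncard_coe_finset,
    countBelow]

theorem HasDensity.tendsto_ratio {A B : Set ℕ} {α β : ℝ} (hA : HasDensity A α)
    (hB : HasDensity B β) (hβ : β ≠ 0) :
    Tendsto (fun x : ℝ => (countBelow A x : ℝ) / countBelow B x) atTop (𝓝 (α / β)) := by
  refine (Tendsto.div hA hB hβ).congr' ?_
  filter_upwards [eventually_gt_atTop 0] with x hx
  exact div_div_div_cancel_right₀ hx.ne' _ _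

theorem splitsIn_or_inertIn_iff {D : ℤ} (hD : IsNegFundDisc D) {l : ℕ} (hl : l.Prime) :
    SplitsIn l D ∨ InertIn l D ↔ IsCoprime D (l : ℤ) := by
  have : NeZero l := ⟨hl.ne_zero⟩
  by_cases h2 : l = 2
  · subst h2
    have h3 : IsCoprime D ((2 : ℕ) : ℤ) ↔ D % 2 = 1 := by
      rw [isCoprime_comm, Prime.coprime_iff_not_dvd (Nat.prime_iff_prime_int.1 Nat.prime_two)]
      omega
    rw [h3]
    simp only [SplitsIn, InertIn, if_true]
    rcases hD with ⟨_, ⟨h, _⟩ | ⟨d, h, _⟩⟩ <;> omega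
  · simp only [SplitsIn, InertIn, if_neg h2, Int.isCoprime_iff_gcd_eq_one]
    have := jacobiSym.eq_zero_iff_not_coprime (a := D) (b := l)
    rcases jacobiSym.trichotomy D l with h | h | h <;> simp_all

theorem not_splitsIn_of_inertIn {D : ℤ} {l : ℕ} (h : InertIn l D) : ¬ SplitsIn l D := by
  unfold InertIn at h
  unfold SplitsIn
  split_ifs at * <;> omega

theorem card_filter_powerset_odd {α : Type*} {U : Finset α} (hU : U.Nonempty) :
    (#{T ∈ U.powerset | Odd #T} : ℝ) = 2 ^ #U / 2 := by
  classical
  have h0 := Finset.sum_powerset_neg_one_pow_card_of_nonempty hU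
  have hpt : ∀ T : Finset α, 2 * (if Odd #T then 1 else 0 : ℤ) = 1 - (-1) ^ #T := by
    intro T
    rcases Nat.even_or_odd #T with h | h
    · simp [h.neg_one_pow, Nat.not_odd_iff_even.2 h]
    · simp [h.neg_one_pow, h]
  have h2 : 2 * (#{T ∈ U.powerset | Odd #T} : ℤ) = 2 ^ #U := by
    rw [card_filter]
    push_cast
    rw [mul_sum, sum_congr rfl fun T _ => hpt T, sum_sub_distrib, h0]
    simp
  have h3 : 2 * (#{T ∈ U.powerset | Odd #T} : ℝ) = 2 ^ #U := by exact_mod_cast h2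
  linarith


theorem hasDensity_choired_p_split {p : ℕ} (hp : p.Prime) {r : ℕ} {q : Fin r → ℕ}
    (hq : ∀ i, (q i).Prime) (hqp : ∀ i, q i ≠ p) (hqinj : Function.Injective q)
    {k : ℕ} (hk : k < r) :
    HasDensity {n : ℕ | -(n : ℤ) ∈ {D : ℤ | IsNegFundDisc D ∧
        Int.gcd D ((p : ℤ) * (∏ i, q i : ℕ)) = 1 ∧ SplitsIn p D ∧
        (∀ i : Fin r, InertIn (q i) D → k ≤ (i : ℕ)) ∧
        Odd (Nat.card {i : Fin r // InertIn (q i) D})}}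
      (2 ^ (r - k) / 2 * (3 / 8 * coprimeMoebiusSum 2 *
        ((p : ℝ) / (2 * (p + 1)) * ∏ i, (q i : ℝ) / (2 * (q i + 1))))) := by
  classical
  set U : Finset (Fin r) := Ici ⟨k, hk⟩ with hU
  set t : Finset (Finset (Fin r)) := {T ∈ U.powerset | Odd #T} with ht
  set L : Finset ℕ := insert p (univ.image q) with hLdef
  have hL : ∀ l ∈ L, l.Prime := by
    intro l hl
    simp only [hLdef, mem_insert, Finset.mem_image, Finset.mem_univ, true_and] at hl
    rcases hl with rfl | ⟨i, rfl⟩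
    exacts [hp, hq i]
  have hpq : ∀ T : Finset (Fin r), p ∉ T.image q := fun T h => by
    obtain ⟨i, -, hi⟩ := Finset.mem_image.1 h
    exact hqp i hi
  set A : Finset (Fin r) → Set ℕ := fun T => {n : ℕ | IsNegFundDisc (-n) ∧
    ∀ l ∈ L, if l ∈ T.image q then InertIn l (-n) else SplitsIn l (-n)} with hA
  have hmemA : ∀ T n, n ∈ A T ↔ IsNegFundDisc (-n) ∧ SplitsIn p (-n) ∧
      ∀ i, if i ∈ T then InertIn (q i) (-n) else SplitsIn (q i) (-n) := by
    intro T n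
    simp only [hA, hLdef, Set.mem_ofPred_eq, forall_mem_insert, if_neg (hpq T),
      Finset.forall_mem_image, Finset.mem_univ, true_imp_iff, hqinj.mem_finset_image]
  have hinert : ∀ T n, n ∈ A T → ∀ i, InertIn (q i) (-n) ↔ i ∈ T := by
    intro T n hn i
    have h := ((hmemA T n).1 hn).2.2 i
    split_ifs at h with hi
    · exact iff_of_true h hi
    · exact iff_of_false (fun h' => not_splitsIn_of_inertIn h' h) hi
  have key := HasDensity.biUnion (t := t) (A := A) (δ := fun _ => 3 / 8 * coprimeMoebiusSum 2 *
    ∏ l ∈ L, (l : ℝ) / (2 * (l + 1))) ?_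
    (fun T _ => hasDensity_isNegFundDisc_splitting hL (T.image q))
  · convert key using 1
    · ext n
      simp only [Set.mem_ofPred_eq, Set.mem_iUnion, exists_prop]
      have hgcd : ∀ D : ℤ, Int.gcd D ((p : ℤ) * (∏ i, q i : ℕ)) = 1 ↔
          IsCoprime D (p : ℤ) ∧ ∀ i, IsCoprime D (q i : ℤ) := by
        intro D
        rw [← Int.isCoprime_iff_gcd_eq_one, IsCoprime.mul_right_iff, Nat.cast_prod,
          IsCoprime.prod_right_iff]
        simp
      constructor
      · rintro ⟨hn, hg, hs, hki, hoddI⟩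
        refine ⟨({i | InertIn (q i) (-n)} : Finset (Fin r)), ?_, ?_⟩
        · rw [ht, mem_filter, mem_powerset]
          refine ⟨fun i hi => ?_, ?_⟩
          · rw [hU, mem_Ici, Fin.le_def]
            exact hki i (mem_filter.1 hi).2
          · rwa [Nat.card_eq_fintype_card, Fintype.card_subtype] at hoddI
        · refine (hmemA _ _).2 ⟨hn, hs, fun i => ?_⟩
          simp only [mem_filter, Finset.mem_univ, true_and]
          split_ifs with hi
          · exact hi
          · exact ((splitsIn_or_inertIn_iff hn (hq i)).2 (((hgcd _).1 hg).2 i)).resolve_right hi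
      · rintro ⟨T, hT, hn⟩
        have hi := hinert T n hn
        rw [hmemA] at hn
        obtain ⟨hn, hs, hT'⟩ := hn
        rw [ht, mem_filter, mem_powerset] at hT
        refine ⟨hn, (hgcd _).2 ⟨(splitsIn_or_inertIn_iff hn hp).1 (Or.inl hs), fun i => ?_⟩, hs,
          fun i h => ?_, ?_⟩
        · refine (splitsIn_or_inertIn_iff hn (hq i)).1 ?_
          have := hT' i
          split_ifs at this
          exacts [Or.inr this, Or.inl this]
        · have := hT.1 ((hi i).1 h)
          rwa [hU, mem_Ici, Fin.le_def] at this
        · simp only [hi]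
          simpa using hT.2
    · have hUne : U.Nonempty := ⟨⟨k, hk⟩, by simp [hU]⟩
      have hpi : p ∉ univ.image q := hpq univ
      rw [sum_const, nsmul_eq_mul, ht, card_filter_powerset_odd hUne, hU, Fin.card_Ici, hLdef,
        prod_insert hpi, prod_image hqinj.injOn]
  · intro T _ T' _ hne
    rw [Function.onFun, Set.disjoint_left]
    intro n hn hn'
    exact hne (Finset.ext fun i => (hinert T n hn i).symm.trans (hinert T' n hn' i))

end

/-- Theorem 4.5 (density of `Q⁻(choired, p+)`, supersingular case): Let `p > 3` be prime,
`q 0, …, q (r-1)` distinct primes different from `p` with `N = ∏ i, q i` squarefree, and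
`0 ≤ k < r`. The set of negative fundamental discriminants `D` coprime to `pN` such that `p`
splits in `ℚ(√D)` and the set `I` of indices `i` with `q i` inert in `ℚ(√D)` satisfies
`I ⊆ {k, …, r-1}` (indices `0`-based, i.e. the first `k` primes all split) and `#I` odd, has
density `pN / (2^(k+2) (p+1) ∏ i (q i + 1))` among all negative fundamental discriminants. -/
theorem density_choired_p_split (p : ℕ) (hp : p.Prime) (hp3 : 3 < p)
    (r : ℕ) (q : Fin r → ℕ) (hq : ∀ i, (q i).Prime) (hqp : ∀ i, q i ≠ p)
    (hqinj : Function.Injective q) (N : ℕ) (hN : N = ∏ i, q i) (hNsf : Squarefree N)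
    (k : ℕ) (hk : k < r) :
    Filter.Tendsto
      (fun x : ℝ =>
        (Nat.card {D : ℤ | IsNegFundDisc D ∧ |(D : ℝ)| < x ∧
            Int.gcd D ((p : ℤ) * N) = 1 ∧ SplitsIn p D ∧
            (∀ i : Fin r, InertIn (q i) D → k ≤ (i : ℕ)) ∧
            Odd (Nat.card {i : Fin r // InertIn (q i) D})} : ℝ) /
          (Nat.card {D : ℤ | IsNegFundDisc D ∧ |(D : ℝ)| < x} : ℝ))
      Filter.atTop
      (nhds ((p : ℝ) * N /
        (2 ^ (k + 2) * ((p : ℝ) + 1) * ∏ i, ((q i : ℝ) + 1)))) := by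
  have hS := (coprimeMoebiusSum_pos 2).ne'
  have hden : HasDensity {n : ℕ | -(n : ℤ) ∈ {D : ℤ | IsNegFundDisc D}}
      (3 / 8 * coprimeMoebiusSum 2) := by
    simpa using hasDensity_isNegFundDisc_splitting (L := ∅) (by simp) ∅
  have hnum := hasDensity_choired_p_split hp hq hqp hqinj hk
  have hlim := hnum.tendsto_ratio hden (mul_ne_zero (by norm_num) hS)
  rw [← hN] at hlim
  convert hlim using 2
  · congr 2
    · rw [← card_int_eq_countBelow fun D hD => hD.1.1]
      congr! 3
      ext D
      simp only [Set.mem_ofPred_eq]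
      tauto
    · rw [← card_int_eq_countBelow fun D hD => hD.1]
      rfl
  · have hprod : ∏ i, (q i : ℝ) / (2 * (q i + 1)) = N / (2 ^ r * ∏ i, ((q i : ℝ) + 1)) := by
      rw [prod_div_distrib, prod_mul_distrib, hN]
      simp
    have hpos : ∏ i, ((q i : ℝ) + 1) ≠ 0 := (prod_pos fun i _ => by positivity).ne'
    obtain ⟨m, rfl⟩ := Nat.exists_eq_add_of_le hk.le
    rw [hprod, Nat.add_sub_cancel_left]
    have : (p : ℝ) + 1 ≠ 0 := by positivity
    field_simp
    ring
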